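/- Let m ≥ 2, 0 < a < b, and let f : ℝ → ℝ be continuously differentiable. Let v ∈ C²(D̄) be axially symmetric about the axis e_{m+1}, satisfy −Δv(z) = f(v(z))/(2|z|) in D and v = 0 on ∂D. Define u : Ā → ℝ by u(y₁,y₂) := v(|y₁||y₂|·e₁, (|y₁|²−|y₂|²)/2), where e₁ ∈ ℝ^m is the first standard basis vector. Then u is twice continuously differentiable in A, O(m)×O(m)-invariant, and satisfies −Δu = f(u) in A and u = 0 on ∂A. -/

import Mathlib

noncomputable section
open Real

/-- Euclidean norm on `ℝ^m × ℝ^m = ℝ^{2m}`. -/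
def pnorm {m : ℕ} (x : EuclideanSpace ℝ (Fin m) × EuclideanSpace ℝ (Fin m)) : ℝ :=
  Real.sqrt (‖x.1‖ ^ 2 + ‖x.2‖ ^ 2)

/-- The Euclidean Laplacian of a function on `ℝ^m × ℝ^m = ℝ^{2m}`. -/
def lapP {m : ℕ} (f : EuclideanSpace ℝ (Fin m) × EuclideanSpace ℝ (Fin m) → ℝ)
    (x : EuclideanSpace ℝ (Fin m) × EuclideanSpace ℝ (Fin m)) : ℝ :=
  (∑ i : Fin m,
    fderiv ℝ (fun y => fderiv ℝ f y ((EuclideanSpace.single i (1 : ℝ)), 0)) x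
      ((EuclideanSpace.single i (1 : ℝ)), 0)) +
  ∑ i : Fin m,
    fderiv ℝ (fun y => fderiv ℝ f y (0, (EuclideanSpace.single i (1 : ℝ)))) x
      (0, (EuclideanSpace.single i (1 : ℝ)))

/-- The annulus `A = {a < |x| < b}` in `ℝ^{2m} = ℝ^m × ℝ^m`. -/
def Ann (m : ℕ) (a b : ℝ) : Set (EuclideanSpace ℝ (Fin m) × EuclideanSpace ℝ (Fin m)) :=
  {x | a < pnorm x ∧ pnorm x < b}

/-- Euclidean norm on `ℝ^m × ℝ = ℝ^{m+1}`. -/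
def qnorm {m : ℕ} (z : EuclideanSpace ℝ (Fin m) × ℝ) : ℝ :=
  Real.sqrt (‖z.1‖ ^ 2 + z.2 ^ 2)

/-- The Euclidean Laplacian of a function on `ℝ^m × ℝ = ℝ^{m+1}`. -/
def lapQ {m : ℕ} (f : EuclideanSpace ℝ (Fin m) × ℝ → ℝ)
    (z : EuclideanSpace ℝ (Fin m) × ℝ) : ℝ :=
  (∑ i : Fin m,
    fderiv ℝ (fun y => fderiv ℝ f y ((EuclideanSpace.single i (1 : ℝ)), 0)) z
      ((EuclideanSpace.single i (1 : ℝ)), 0)) +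
  fderiv ℝ (fun y => fderiv ℝ f y (0, (1 : ℝ))) z (0, (1 : ℝ))

/-- The annulus `D = {a²/2 < |z| < b²/2}` in `ℝ^{m+1} = ℝ^m × ℝ`. -/
def AnnD (m : ℕ) (a b : ℝ) : Set (EuclideanSpace ℝ (Fin m) × ℝ) :=
  {z | a ^ 2 / 2 < qnorm z ∧ qnorm z < b ^ 2 / 2}

open Topology Filter

lemma aux_second {X Y : Type*} [NormedAddCommGroup X] [NormedSpace ℝ X]
    [NormedAddCommGroup Y] [NormedSpace ℝ Y] (v : Y → ℝ) (Φ Ψ : X → Y) (x e : X) (κ : Y)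
    (hv : ContDiffAt ℝ 2 v (Φ x)) (hΦ : ContDiffAt ℝ 2 Φ x)
    (hΨ : ∀ᶠ y in 𝓝 x, HasLineDerivAt ℝ Φ (Ψ y) y e)
    (hΨd : DifferentiableAt ℝ Ψ x) (hκ : HasLineDerivAt ℝ Ψ κ x e) :
    fderiv ℝ (fun y => fderiv ℝ (fun y => v (Φ y)) y e) x e
      = fderiv ℝ (fderiv ℝ v) (Φ x) (Ψ x) (Ψ x) + fderiv ℝ v (Φ x) κ := by
  have hfd : ∀ (F : X → Y) (y : X) (k : Y), DifferentiableAt ℝ F y → HasLineDerivAt ℝ F k y e →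
      fderiv ℝ F y e = k := by
    intro F y k h1 h2
    exact HasDerivAt.unique (h1.hasFDerivAt.hasLineDerivAt e) h2
  have hΦev : ∀ᶠ y in 𝓝 x, ContDiffAt ℝ 2 Φ y := hΦ.eventually (by simp)
  have hvev : ∀ᶠ y in 𝓝 x, ContDiffAt ℝ 2 v (Φ y) :=
    hΦ.continuousAt.eventually (hv.eventually (by simp))
  have hE : (fun y => fderiv ℝ (fun y => v (Φ y)) y e) =ᶠ[𝓝 x]
      (fun y => fderiv ℝ v (Φ y) (Ψ y)) := by
    filter_upwards [hΦev, hvev, hΨ] with y h1 h2 h3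
    have d1 := h1.differentiableAt (by norm_num)
    have d2 := h2.differentiableAt (by norm_num)
    have := fderiv_comp y d2 d1
    have h4 : fderiv ℝ (fun y => v (Φ y)) y = (fderiv ℝ v (Φ y)).comp (fderiv ℝ Φ y) := this
    rw [h4, ContinuousLinearMap.comp_apply, hfd Φ y _ d1 h3]
  rw [hE.fderiv_eq]
  have hB : DifferentiableAt ℝ (fderiv ℝ v) (Φ x) :=
    (hv.fderiv_right (m := 1) (by norm_num)).differentiableAt (by norm_num)
  have d1 := hΦ.differentiableAt (by norm_num)
  have hBc : HasFDerivAt (fun y => fderiv ℝ v (Φ y))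
      ((fderiv ℝ (fderiv ℝ v) (Φ x)).comp (fderiv ℝ Φ x)) x :=
    hB.hasFDerivAt.comp x d1.hasFDerivAt
  have := (hBc.clm_apply hΨd.hasFDerivAt).fderiv
  rw [this]
  simp [hfd Ψ x κ hΨd hκ, hfd Φ x _ d1 hΨ.self_of_nhds]
  ring

lemma aux_applyD {Y : Type*} [NormedAddCommGroup Y] [NormedSpace ℝ Y] (v : Y → ℝ) (z w w' : Y)
    (hv : ContDiffAt ℝ 2 v z) :
    fderiv ℝ (fun y => fderiv ℝ v y w) z w' = fderiv ℝ (fderiv ℝ v) z w' w := by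
  have hB : DifferentiableAt ℝ (fderiv ℝ v) z :=
    (hv.fderiv_right (m := 1) (by norm_num)).differentiableAt (by norm_num)
  have := (hB.hasFDerivAt.clm_apply (hasFDerivAt_const w z)).fderiv
  rw [this]
  simp

lemma qnorm_congr {m : ℕ} (z w : EuclideanSpace ℝ (Fin m) × ℝ) (h1 : ‖z.1‖ = ‖w.1‖)
    (h2 : z.2 ^ 2 = w.2 ^ 2) : qnorm z = qnorm w := by
  simp [qnorm, h1, h2]

lemma continuous_qnorm {m : ℕ} : Continuous (qnorm (m := m)) := by
  unfold qnorm; fun_prop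

lemma continuous_pnorm {m : ℕ} : Continuous (pnorm (m := m)) := by
  unfold pnorm; fun_prop

lemma isOpen_AnnD (m : ℕ) (a b : ℝ) : IsOpen (AnnD m a b) :=
  (isOpen_lt continuous_const continuous_qnorm).inter (isOpen_lt continuous_qnorm continuous_const)

lemma isOpen_Ann (m : ℕ) (a b : ℝ) : IsOpen (Ann m a b) :=
  (isOpen_lt continuous_const continuous_pnorm).inter (isOpen_lt continuous_pnorm continuous_const)

lemma aux_tangent {m : ℕ} {a b : ℝ} (v : EuclideanSpace ℝ (Fin m) × ℝ → ℝ)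
    (hax : ∀ z ∈ AnnD m a b, ∀ w ∈ AnnD m a b, ‖z.1‖ = ‖w.1‖ → z.2 = w.2 → v z = v w)
    (z : EuclideanSpace ℝ (Fin m) × ℝ) (hz : z ∈ AnnD m a b) (hv : DifferentiableAt ℝ v z)
    (ξ : EuclideanSpace ℝ (Fin m)) (hξ : inner ℝ z.1 ξ = 0) (hz0 : z.1 ≠ 0) :
    fderiv ℝ v z (ξ, 0) = 0 := by
  by_cases h0 : ξ = 0
  · subst h0
    exact map_zero (fderiv ℝ v z)
  have hξn : ‖ξ‖ ≠ 0 := by simpa using h0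
  set k : ℝ := ‖z.1‖ / ‖ξ‖ with hk
  have hk0 : k ≠ 0 := by simp [hk, hz0, h0]
  have hkn : k * ‖ξ‖ = ‖z.1‖ := by rw [hk]; field_simp
  let c : ℝ → EuclideanSpace ℝ (Fin m) × ℝ :=
    fun s => (Real.cos s • z.1 + (Real.sin s * k) • ξ, z.2)
  have hc0 : c 0 = z := by simp [c]
  have hnorm : ∀ s, ‖(c s).1‖ = ‖z.1‖ := by
    intro s
    have : ‖(c s).1‖ ^ 2 = ‖z.1‖ ^ 2 := by
      simp only [c]
      rw [norm_add_sq_real, norm_smul, norm_smul, inner_smul_left, inner_smul_right, hξ]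
      simp only [Real.norm_eq_abs, mul_pow, sq_abs, abs_mul]
      have e : k ^ 2 * ‖ξ‖ ^ 2 = ‖z.1‖ ^ 2 := by rw [← hkn]; ring
      linear_combination (Real.sin s) ^ 2 * e + ‖z.1‖ ^ 2 * Real.sin_sq_add_cos_sq s
    exact (sq_eq_sq₀ (norm_nonneg _) (norm_nonneg _)).1 this
  have hcD : ∀ s, c s ∈ AnnD m a b := by
    intro s
    have : qnorm (c s) = qnorm z := qnorm_congr _ _ (hnorm s) rfl
    simpa [AnnD, this] using hz
  have hconst : ∀ s, v (c s) = v z := fun s => hax _ (hcD s) _ hz (hnorm s) rfl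
  have hcd : HasDerivAt c (k • ξ, 0) 0 := by
    have h1 : HasDerivAt (fun s : ℝ => Real.cos s • z.1 + (Real.sin s * k) • ξ) (k • ξ) 0 := by
      have := ((Real.hasDerivAt_cos 0).smul_const z.1).add
        (((Real.hasDerivAt_sin 0).mul_const k).smul_const ξ)
      exact HasDerivAt.congr_deriv this (by simp)
    exact h1.prodMk (hasDerivAt_const _ _)
  have hcomp : HasDerivAt (fun s => v (c s)) (fderiv ℝ v z (k • ξ, 0)) 0 := by
    have h := hv.hasFDerivAt
    rw [← hc0] at h
    have := h.comp_hasDerivAt 0 hcd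
    rw [hc0] at this
    exact this
  have h2 : HasDerivAt (fun s => v (c s)) 0 0 := by
    have : (fun s => v (c s)) = fun _ => v z := funext hconst
    rw [this]; exact hasDerivAt_const _ _
  have h3 := hcomp.unique h2
  have h4 : ((k • ξ, 0) : EuclideanSpace ℝ (Fin m) × ℝ) = k • (ξ, 0) := by simp
  rw [h4, map_smul] at h3
  simpa [hk0] using h3

lemma aux_decomp {m : ℕ} (L : EuclideanSpace ℝ (Fin m) × ℝ →L[ℝ] ℝ)
    (p : EuclideanSpace ℝ (Fin m)) :
    ∑ i : Fin m, p i * L (EuclideanSpace.single i 1, 0) = L (p, 0) := by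
  have h : ∑ i : Fin m, p i •
      ((EuclideanSpace.single i (1 : ℝ), 0) : EuclideanSpace ℝ (Fin m) × ℝ) = (p, 0) := by
    refine Prod.ext ?_ ?_
    · rw [Prod.fst_sum]
      ext j
      simp [Finset.sum_apply, Pi.single_apply]
    · rw [Prod.snd_sum]; simp
  rw [← h, map_sum]
  simp only [map_smul, smul_eq_mul]

lemma aux_radial {m : ℕ} {a b : ℝ} (v : EuclideanSpace ℝ (Fin m) × ℝ → ℝ)
    (hreg : ContDiffOn ℝ 2 v (AnnD m a b))
    (hax : ∀ z ∈ AnnD m a b, ∀ w ∈ AnnD m a b, ‖z.1‖ = ‖w.1‖ → z.2 = w.2 → v z = v w)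
    (z : EuclideanSpace ℝ (Fin m) × ℝ) (hz : z ∈ AnnD m a b) (w : EuclideanSpace ℝ (Fin m)) :
    (m - 1 : ℝ) * fderiv ℝ v z (w, 0) + fderiv ℝ (fderiv ℝ v) z (z.1, 0) (w, 0)
      = inner ℝ z.1 w * ∑ i : Fin m, fderiv ℝ (fderiv ℝ v) z (EuclideanSpace.single i 1, 0)
          (EuclideanSpace.single i 1, 0) := by
  have hcd : ∀ y ∈ AnnD m a b, ContDiffAt ℝ 2 v y := fun y hy =>
    hreg.contDiffAt ((isOpen_AnnD m a b).mem_nhds hy)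
  have hi : ∀ i : Fin m, fderiv ℝ v z (w, 0)
      + z.1 i * fderiv ℝ (fderiv ℝ v) z (EuclideanSpace.single i 1, 0) (w, 0)
      - w i * fderiv ℝ v z (EuclideanSpace.single i 1, 0)
      - inner ℝ z.1 w * fderiv ℝ (fderiv ℝ v) z (EuclideanSpace.single i 1, 0)
          (EuclideanSpace.single i 1, 0) = 0 := by
    intro i
    set e : EuclideanSpace ℝ (Fin m) := EuclideanSpace.single i 1 with he
    let G : EuclideanSpace ℝ (Fin m) × ℝ → ℝ := fun y =>
      inner ℝ y.1 e * fderiv ℝ v y (w, 0) - inner ℝ y.1 w * fderiv ℝ v y (e, 0)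
    have hG : G =ᶠ[𝓝 z] fun _ => 0 := by
      filter_upwards [(isOpen_AnnD m a b).mem_nhds hz] with y hy
      by_cases hy0 : y.1 = 0
      · simp [G, hy0]
      have := aux_tangent v hax y hy ((hcd y hy).differentiableAt (by norm_num))
        (inner ℝ y.1 e • w - inner ℝ y.1 w • e)
        (by rw [inner_sub_right, inner_smul_right, inner_smul_right]; ring) hy0
      have h4 : ((inner ℝ y.1 e • w - inner ℝ y.1 w • e, 0) : EuclideanSpace ℝ (Fin m) × ℝ)
        = inner ℝ y.1 e • (w, 0) - inner ℝ y.1 w • (e, 0) := by simp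
      rw [h4, map_sub, map_smul, map_smul] at this
      simpa [G] using this
    have hB : DifferentiableAt ℝ (fderiv ℝ v) z :=
      ((hcd z hz).fderiv_right (m := 1) (by norm_num)).differentiableAt (by norm_num)
    have hD : ∀ w : EuclideanSpace ℝ (Fin m), HasLineDerivAt ℝ (fun y => fderiv ℝ v y (w, 0))
        (fderiv ℝ (fderiv ℝ v) z (e, 0) (w, 0)) z (e, 0) := by
      intro w
      have := (hB.hasFDerivAt.clm_apply
        (hasFDerivAt_const ((w, 0) : EuclideanSpace ℝ (Fin m) × ℝ) z)).hasLineDerivAt (e, 0)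
      simpa using this
    have hI : ∀ w : EuclideanSpace ℝ (Fin m), HasLineDerivAt ℝ
        (fun y : EuclideanSpace ℝ (Fin m) × ℝ => inner ℝ y.1 w) (inner ℝ e w) z (e, 0) := by
      intro w
      have h1 : HasDerivAt (fun s : ℝ => z.1 + s • e) e 0 := by
        simpa using ((hasDerivAt_id (0 : ℝ)).smul_const e).const_add z.1
      have := h1.inner ℝ (hasDerivAt_const (0 : ℝ) w)
      simpa [HasLineDerivAt] using this
    have h1 : HasLineDerivAt ℝ G _ z (e, 0) :=
      HasDerivAt.sub (HasDerivAt.mul (hI e) (hD w)) (HasDerivAt.mul (hI w) (hD e))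
    have h2 : HasLineDerivAt ℝ G 0 z (e, 0) := by
      have : HasFDerivAt G (0 : EuclideanSpace ℝ (Fin m) × ℝ →L[ℝ] ℝ) z :=
        (hasFDerivAt_const (0 : ℝ) z).congr_of_eventuallyEq hG
      simpa using this.hasLineDerivAt (e, 0)
    have h3 := HasDerivAt.unique h1 h2
    have a1 : inner ℝ e e = (1 : ℝ) := by simp [he]
    have a2 : inner ℝ e w = w i := by simp [he, EuclideanSpace.inner_single_left]
    have a3 : inner ℝ z.1 e = z.1 i := by simp [he, EuclideanSpace.inner_single_right]
    simp only [zero_smul, add_zero, a1, a2, a3] at h3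
    linarith
  have hsum := Finset.sum_eq_zero (s := Finset.univ) (fun i _ => hi i)
  simp only [Finset.sum_sub_distrib, Finset.sum_add_distrib, ← Finset.mul_sum] at hsum
  have s1 : ∑ i : Fin m, z.1 i * fderiv ℝ (fderiv ℝ v) z (EuclideanSpace.single i 1, 0) (w, 0)
      = fderiv ℝ (fderiv ℝ v) z (z.1, 0) (w, 0) := by
    exact aux_decomp ((fderiv ℝ (fderiv ℝ v) z).flip (w, 0)) z.1
  have s2 : ∑ i : Fin m, w i * fderiv ℝ v z (EuclideanSpace.single i 1, 0)
      = fderiv ℝ v z (w, 0) := by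
    exact aux_decomp (fderiv ℝ v z) w
  rw [s1, s2] at hsum
  simp at hsum
  linarith

lemma aux_line {m : ℕ} (p : EuclideanSpace ℝ (Fin m)) (i : Fin m) :
    HasDerivAt (fun s : ℝ => p + s • EuclideanSpace.single i (1 : ℝ))
      (EuclideanSpace.single i (1 : ℝ)) 0 := by
  simpa using ((hasDerivAt_id (0 : ℝ)).smul_const (EuclideanSpace.single i (1 : ℝ))).const_add p

lemma aux_normsq {m : ℕ} (p : EuclideanSpace ℝ (Fin m)) (i : Fin m) :
    HasDerivAt (fun s : ℝ => ‖p + s • EuclideanSpace.single i (1 : ℝ)‖ ^ 2) (2 * p i) 0 := by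
  refine (aux_line p i).norm_sq.congr_deriv ?_
  simp [EuclideanSpace.inner_single_right]

lemma aux_norm {m : ℕ} (p : EuclideanSpace ℝ (Fin m)) (hp : p ≠ 0) (i : Fin m) :
    HasDerivAt (fun s : ℝ => ‖p + s • EuclideanSpace.single i (1 : ℝ)‖) (p i / ‖p‖) 0 := by
  have h := (aux_normsq p i).sqrt (by simpa using hp)
  simp only [Real.sqrt_sq (norm_nonneg _)] at h
  refine h.congr_deriv ?_
  simp
  have : ‖p‖ ≠ 0 := by simpa using hp
  field_simp

lemma aux_coord {m : ℕ} (p : EuclideanSpace ℝ (Fin m)) (i : Fin m) :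
    HasDerivAt (fun s : ℝ => (p + s • EuclideanSpace.single i (1 : ℝ)) i) 1 0 := by
  have : (fun s : ℝ => (p + s • EuclideanSpace.single i (1 : ℝ)) i) = fun s => p i + s := by
    funext s; simp
  rw [this]
  simpa using (hasDerivAt_id (0 : ℝ)).const_add (p i)

/-- The lifting map. -/
def liftMap {m : ℕ} (σ : ℝ) (y : EuclideanSpace ℝ (Fin m) × EuclideanSpace ℝ (Fin m)) :
    EuclideanSpace ℝ (Fin m) × ℝ := (‖y.2‖ • y.1, σ * ((‖y.1‖ ^ 2 - ‖y.2‖ ^ 2) / 2))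

lemma liftMap_contDiffAt {m : ℕ} (σ : ℝ) (x : EuclideanSpace ℝ (Fin m) × EuclideanSpace ℝ (Fin m))
    (hx : x.2 ≠ 0) : ContDiffAt ℝ 2 (liftMap σ) x := by
  have hn : ContDiffAt ℝ 2
      (fun y : EuclideanSpace ℝ (Fin m) × EuclideanSpace ℝ (Fin m) => ‖y.2‖) x :=
    (contDiffAt_norm ℝ hx).comp x contDiffAt_snd
  have h1 : ContDiffAt ℝ 2
      (fun y : EuclideanSpace ℝ (Fin m) × EuclideanSpace ℝ (Fin m) => ‖y.1‖ ^ 2) x :=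
    contDiffAt_fst.norm_sq ℝ
  refine (hn.smul contDiffAt_fst).prodMk ?_
  exact contDiffAt_const.mul ((h1.sub (hn.pow 2)).div_const 2)

lemma aux_key {m : ℕ} {a b : ℝ} (v : EuclideanSpace ℝ (Fin m) × ℝ → ℝ)
    (hreg : ContDiffOn ℝ 2 v (AnnD m a b))
    (hax : ∀ z ∈ AnnD m a b, ∀ w ∈ AnnD m a b, ‖z.1‖ = ‖w.1‖ → z.2 = w.2 → v z = v w)
    (σ : ℝ) (hσ : σ ^ 2 = 1) (x : EuclideanSpace ℝ (Fin m) × EuclideanSpace ℝ (Fin m))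
    (hx : x.2 ≠ 0) (hz : liftMap σ x ∈ AnnD m a b) :
    lapP (fun y => v (liftMap σ y)) x = (‖x.1‖ ^ 2 + ‖x.2‖ ^ 2) * lapQ v (liftMap σ x) := by
  have hv : ContDiffAt ℝ 2 v (liftMap σ x) :=
    hreg.contDiffAt ((isOpen_AnnD m a b).mem_nhds hz)
  have hΦ := liftMap_contDiffAt σ x hx
  have hr : ‖x.2‖ ≠ 0 := by simpa using hx
  have hev : ∀ᶠ y in 𝓝 x, y.2 ≠ 0 := continuousAt_snd.eventually_ne hx
  have hnd : DifferentiableAt ℝ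
      (fun y : EuclideanSpace ℝ (Fin m) × EuclideanSpace ℝ (Fin m) => ‖y.2‖) x :=
    ((contDiffAt_norm ℝ hx).comp (n := 1) x contDiffAt_snd).differentiableAt (by norm_num)
  have hc1 : ∀ i, DifferentiableAt ℝ
      (fun y : EuclideanSpace ℝ (Fin m) × EuclideanSpace ℝ (Fin m) => y.1 i) x := by
    intro i; fun_prop
  have hc2 : ∀ i, DifferentiableAt ℝ
      (fun y : EuclideanSpace ℝ (Fin m) × EuclideanSpace ℝ (Fin m) => y.2 i) x := by
    intro i; fun_prop
  -- first block
  have H1 : ∀ i : Fin m, fderiv ℝ (fun y => fderiv ℝ (fun y => v (liftMap σ y)) y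
      ((EuclideanSpace.single i (1 : ℝ)), 0)) x ((EuclideanSpace.single i (1 : ℝ)), 0)
      = fderiv ℝ (fderiv ℝ v) (liftMap σ x) (‖x.2‖ • EuclideanSpace.single i (1 : ℝ), σ * x.1 i)
          (‖x.2‖ • EuclideanSpace.single i (1 : ℝ), σ * x.1 i)
        + fderiv ℝ v (liftMap σ x) (0, σ) := by
    intro i
    refine aux_second v (liftMap σ)
      (fun y => (‖y.2‖ • EuclideanSpace.single i (1 : ℝ), σ * y.1 i)) x _ (0, σ) hv hΦ ?_ ?_ ?_
    · filter_upwards with y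
      have h1 := (aux_line y.1 i).const_smul ‖y.2‖
      have h2 := (((aux_normsq y.1 i).sub_const (‖y.2‖ ^ 2)).div_const 2).const_mul σ
      have := h1.prodMk h2
      simp only [HasLineDerivAt, liftMap, Prod.smul_mk, Prod.fst_add, Prod.snd_add, smul_zero,
        add_zero]
      refine HasDerivAt.congr_deriv this ?_
      ext <;> simp
    · exact (hnd.smul_const _).prodMk ((hc1 i).const_mul σ)
    · simp only [HasLineDerivAt, Prod.smul_mk, Prod.fst_add, Prod.snd_add, smul_zero, add_zero]
      refine ((hasDerivAt_const (0 : ℝ) _).prodMk ((aux_coord x.1 i).const_mul σ)).congr_deriv ?_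
      simp
  -- second block
  have H2 : ∀ i : Fin m, fderiv ℝ (fun y => fderiv ℝ (fun y => v (liftMap σ y)) y
      (0, (EuclideanSpace.single i (1 : ℝ)))) x (0, (EuclideanSpace.single i (1 : ℝ)))
      = fderiv ℝ (fderiv ℝ v) (liftMap σ x) ((x.2 i / ‖x.2‖) • x.1, σ * (- x.2 i))
          ((x.2 i / ‖x.2‖) • x.1, σ * (- x.2 i))
        + fderiv ℝ v (liftMap σ x) ((1 / ‖x.2‖ - x.2 i ^ 2 / ‖x.2‖ ^ 3) • x.1, -σ) := by
    intro i
    refine aux_second v (liftMap σ)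
      (fun y => ((y.2 i / ‖y.2‖) • y.1, σ * (- y.2 i))) x _ _ hv hΦ ?_ ?_ ?_
    · filter_upwards [hev] with y hy
      have h1 := (aux_norm y.2 hy i).smul_const y.1
      have h2 := (((aux_normsq y.2 i).const_sub (‖y.1‖ ^ 2)).div_const 2).const_mul σ
      have := h1.prodMk h2
      simp only [HasLineDerivAt, liftMap, Prod.smul_mk, Prod.fst_add, Prod.snd_add, smul_zero,
        add_zero]
      refine HasDerivAt.congr_deriv this ?_
      ext
      · simp
      · simp; ring
    · have hdiv : DifferentiableAt ℝ
          (fun y : EuclideanSpace ℝ (Fin m) × EuclideanSpace ℝ (Fin m) => y.2 i / ‖y.2‖) x :=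
        by simpa only [div_eq_mul_inv] using (hc2 i).fun_mul (hnd.fun_inv hr)
      exact (hdiv.smul differentiableAt_fst).prodMk ((hc2 i).neg.const_mul σ)
    · simp only [HasLineDerivAt, Prod.smul_mk, Prod.fst_add, Prod.snd_add, smul_zero, add_zero]
      have h1 := ((aux_coord x.2 i).div (aux_norm x.2 hx i) (by simpa using hx)).smul_const x.1
      refine (h1.prodMk ((aux_coord x.2 i).neg.const_mul σ)).congr_deriv ?_
      refine Prod.ext ?_ (by simp)
      simp only [zero_smul, add_zero]
      congr 1
      field_simp
  have hQ : lapQ v (liftMap σ x) = (∑ i : Fin m, fderiv ℝ (fderiv ℝ v) (liftMap σ x)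
      (EuclideanSpace.single i 1, 0) (EuclideanSpace.single i 1, 0))
      + fderiv ℝ (fderiv ℝ v) (liftMap σ x) (0, 1) (0, 1) := by
    simp only [lapQ, aux_applyD v _ _ _ hv]
  have hrad := aux_radial v hreg hax (liftMap σ x) hz x.1
  rw [hQ]
  simp only [lapP, H1, H2]
  have hrad1 : (liftMap σ x).1 = ‖x.2‖ • x.1 := rfl
  rw [hrad1, real_inner_smul_left, real_inner_self_eq_norm_sq] at hrad
  generalize hB : fderiv ℝ (fderiv ℝ v) (liftMap σ x) = B at *
  generalize hL : fderiv ℝ v (liftMap σ x) = L at *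
  have split : ∀ (c d : ℝ) (p : EuclideanSpace ℝ (Fin m)),
      ((c • p, d) : EuclideanSpace ℝ (Fin m) × ℝ) = c • (p, (0 : ℝ)) + d • (0, (1 : ℝ)) := by
    intro c d p; simp
  have hs0 : ((‖x.2‖ • x.1, (0 : ℝ)) : EuclideanSpace ℝ (Fin m) × ℝ) = ‖x.2‖ • (x.1, (0 : ℝ)) := by
    simp
  have hs1 : ((0, σ) : EuclideanSpace ℝ (Fin m) × ℝ) = σ • (0, (1 : ℝ)) := by simp
  rw [hs0, map_smul] at hrad
  have n1 : ∑ i : Fin m, x.1 i ^ 2 = ‖x.1‖ ^ 2 := by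
    simp [EuclideanSpace.norm_sq_eq]
  have n2 : ∑ i : Fin m, x.2 i ^ 2 = ‖x.2‖ ^ 2 := by
    simp [EuclideanSpace.norm_sq_eq]
  have d1 := aux_decomp (B (0, 1)) x.1
  have d2 := aux_decomp (B.flip (0, 1)) x.1
  simp only [ContinuousLinearMap.flip_apply] at d2
  have S1 : ∑ i : Fin m, (B (‖x.2‖ • EuclideanSpace.single i (1 : ℝ), σ * x.1 i)
          (‖x.2‖ • EuclideanSpace.single i (1 : ℝ), σ * x.1 i) + L (0, σ))
      = ‖x.2‖ ^ 2 * (∑ i : Fin m, B (EuclideanSpace.single i 1, 0) (EuclideanSpace.single i 1, 0))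
        + ‖x.2‖ * σ * (B (x.1, 0) (0, 1) + B (0, 1) (x.1, 0)) + ‖x.1‖ ^ 2 * B (0, 1) (0, 1)
        + m * (σ * L (0, 1)) := by
    rw [Finset.sum_add_distrib, ← d1, ← d2, ← n1, hs1, Finset.sum_mul,
      ← Finset.sum_add_distrib (f := fun i : Fin m => x.1 i * B (EuclideanSpace.single i 1, 0) (0, 1)),
      Finset.mul_sum, Finset.mul_sum,
      ← Finset.sum_add_distrib (f := fun i : Fin m =>
        ‖x.2‖ ^ 2 * B (EuclideanSpace.single i 1, 0) (EuclideanSpace.single i 1, 0)),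
      ← Finset.sum_add_distrib (g := fun i : Fin m => x.1 i ^ 2 * B (0, 1) (0, 1))]
    congr 1
    · refine Finset.sum_congr rfl fun i _ => ?_
      rw [split]
      simp only [map_add, map_smul, add_apply, smul_apply, smul_eq_mul]
      linear_combination x.1 i ^ 2 * B (0, 1) (0, 1) * hσ
    · simp only [map_smul]; simp
  have S2 : ∑ i : Fin m, (B ((x.2 i / ‖x.2‖) • x.1, σ * (- x.2 i))
          ((x.2 i / ‖x.2‖) • x.1, σ * (- x.2 i))
        + L ((1 / ‖x.2‖ - x.2 i ^ 2 / ‖x.2‖ ^ 3) • x.1, -σ))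
      = B (x.1, 0) (x.1, 0) - ‖x.2‖ * σ * (B (x.1, 0) (0, 1) + B (0, 1) (x.1, 0))
        + ‖x.2‖ ^ 2 * B (0, 1) (0, 1) + (m - 1) / ‖x.2‖ * L (x.1, 0) - m * (σ * L (0, 1)) := by
    have : ∀ i : Fin m, (B ((x.2 i / ‖x.2‖) • x.1, σ * (- x.2 i))
          ((x.2 i / ‖x.2‖) • x.1, σ * (- x.2 i))
        + L ((1 / ‖x.2‖ - x.2 i ^ 2 / ‖x.2‖ ^ 3) • x.1, -σ))
        = x.2 i ^ 2 * (B (x.1, 0) (x.1, 0) / ‖x.2‖ ^ 2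
          - σ / ‖x.2‖ * (B (x.1, 0) (0, 1) + B (0, 1) (x.1, 0)) + B (0, 1) (0, 1)
          - L (x.1, 0) / ‖x.2‖ ^ 3) + (L (x.1, 0) / ‖x.2‖ - σ * L (0, 1)) := by
      intro i
      rw [split, split]
      simp only [map_add, map_smul, add_apply, smul_apply, smul_eq_mul]
      linear_combination x.2 i ^ 2 * B (0, 1) (0, 1) * hσ
    simp only [this]
    rw [Finset.sum_add_distrib, ← Finset.sum_mul, n2]
    simp
    field_simp
    ring
  rw [S1, S2]
  simp only [smul_apply, smul_eq_mul] at hrad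
  field_simp
  linear_combination hrad

lemma lapP_congr {m : ℕ} {g h : EuclideanSpace ℝ (Fin m) × EuclideanSpace ℝ (Fin m) → ℝ}
    {x : EuclideanSpace ℝ (Fin m) × EuclideanSpace ℝ (Fin m)} (H : g =ᶠ[𝓝 x] h) :
    lapP g x = lapP h x := by
  have : ∀ e, (fun y => fderiv ℝ g y e) =ᶠ[𝓝 x] (fun y => fderiv ℝ h y e) := by
    intro e
    filter_upwards [H.fderiv (𝕜 := ℝ)] with y hy
    rw [hy]
  simp only [lapP, fun e => (this e).fderiv_eq (𝕜 := ℝ)]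

lemma lapP_swap {m : ℕ} (g : EuclideanSpace ℝ (Fin m) × EuclideanSpace ℝ (Fin m) → ℝ)
    (x : EuclideanSpace ℝ (Fin m) × EuclideanSpace ℝ (Fin m)) :
    lapP (fun y => g y.swap) x = lapP g x.swap := by
  have hf : ∀ (G : EuclideanSpace ℝ (Fin m) × EuclideanSpace ℝ (Fin m) → ℝ)
      (y e : EuclideanSpace ℝ (Fin m) × EuclideanSpace ℝ (Fin m)),
      fderiv ℝ (fun y => G y.swap) y e = fderiv ℝ G y.swap e.swap := by
    intro G y e
    have := (ContinuousLinearEquiv.prodComm ℝ (EuclideanSpace ℝ (Fin m))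
      (EuclideanSpace ℝ (Fin m))).comp_right_fderiv (f := G) (x := y)
    have h2 : fderiv ℝ (fun y => G y.swap) y = _ := this
    rw [h2]; rfl
  have hf2 : ∀ e : EuclideanSpace ℝ (Fin m) × EuclideanSpace ℝ (Fin m),
      fderiv ℝ (fun y => fderiv ℝ (fun y => g y.swap) y e) x e
      = fderiv ℝ (fun y => fderiv ℝ g y e.swap) x.swap e.swap := by
    intro e
    rw [← hf (fun y => fderiv ℝ g y e.swap) x e]
    simp only [hf]
  simp only [lapP, hf2, Prod.swap_prod_mk]
  rw [add_comm]

lemma qnorm_of {m : ℕ} (z : EuclideanSpace ℝ (Fin m) × ℝ)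
    (x : EuclideanSpace ℝ (Fin m) × EuclideanSpace ℝ (Fin m)) (h1 : ‖z.1‖ = ‖x.1‖ * ‖x.2‖)
    (h2 : z.2 ^ 2 = ((‖x.1‖ ^ 2 - ‖x.2‖ ^ 2) / 2) ^ 2) : qnorm z = pnorm x ^ 2 / 2 := by
  rw [qnorm, pnorm, Real.sq_sqrt (by positivity), h1, h2]
  rw [show (‖x.1‖ * ‖x.2‖) ^ 2 + ((‖x.1‖ ^ 2 - ‖x.2‖ ^ 2) / 2) ^ 2
    = ((‖x.1‖ ^ 2 + ‖x.2‖ ^ 2) / 2) ^ 2 by ring, Real.sqrt_sq (by positivity)]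

lemma mem_AnnD_of {m : ℕ} {a b : ℝ} (ha : 0 < a) (hab : a < b) (z : EuclideanSpace ℝ (Fin m) × ℝ)
    (x : EuclideanSpace ℝ (Fin m) × EuclideanSpace ℝ (Fin m)) (hx : x ∈ Ann m a b)
    (h1 : ‖z.1‖ = ‖x.1‖ * ‖x.2‖)
    (h2 : z.2 ^ 2 = ((‖x.1‖ ^ 2 - ‖x.2‖ ^ 2) / 2) ^ 2) : z ∈ AnnD m a b := by
  obtain ⟨l, u⟩ := hx
  refine ⟨?_, ?_⟩ <;> rw [qnorm_of z x h1 h2]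
  · nlinarith
  · nlinarith

lemma frontier_AnnD_of {m : ℕ} {a b : ℝ} (ha : 0 < a) (hab : a < b)
    (z : EuclideanSpace ℝ (Fin m) × ℝ) (hz : qnorm z = a ^ 2 / 2 ∨ qnorm z = b ^ 2 / 2) :
    z ∈ frontier (AnnD m a b) := by
  have hq : ∀ s : ℝ, 0 < s → qnorm (s • z) = s * qnorm z := by
    intro s hs
    simp only [qnorm, Prod.smul_fst, Prod.smul_snd, norm_smul, smul_eq_mul, Real.norm_eq_abs,
      mul_pow, sq_abs]
    rw [← mul_add, Real.sqrt_mul (by positivity), Real.sqrt_sq hs.le]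
  have hlt : a ^ 2 / 2 < b ^ 2 / 2 := by nlinarith
  have ha2 : 0 < a ^ 2 / 2 := by positivity
  have hcont : Tendsto (fun s : ℝ => s • z) (𝓝 1) (𝓝 z) := by
    have : Continuous (fun s : ℝ => s • z) := by fun_prop
    simpa using this.tendsto 1
  have hcq : Tendsto (fun s : ℝ => s * qnorm z) (𝓝 1) (𝓝 (qnorm z)) := by
    have : Continuous (fun s : ℝ => s * qnorm z) := by fun_prop
    simpa using this.tendsto 1
  have hpos : ∀ᶠ s : ℝ in 𝓝 1, 0 < s := lt_mem_nhds one_pos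
  rw [(isOpen_AnnD m a b).frontier_eq]
  refine ⟨?_, ?_⟩
  · rcases hz with hz | hz
    · refine mem_closure_of_tendsto (hcont.mono_left (nhdsWithin_le_nhds (s := Set.Ioi 1))) ?_
      have h1 : ∀ᶠ s : ℝ in 𝓝 1, s * qnorm z < b ^ 2 / 2 :=
        hcq.eventually (gt_mem_nhds (by rw [hz]; exact hlt))
      filter_upwards [nhdsWithin_le_nhds h1, nhdsWithin_le_nhds hpos, self_mem_nhdsWithin]
        with s h1 h2 h3
      have h3 : 1 < s := h3
      refine ⟨?_, ?_⟩ <;> rw [hq s h2]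
      · rw [hz]; nlinarith
      · exact h1
    · refine mem_closure_of_tendsto (hcont.mono_left (nhdsWithin_le_nhds (s := Set.Iio 1))) ?_
      have h1 : ∀ᶠ s : ℝ in 𝓝 1, a ^ 2 / 2 < s * qnorm z :=
        hcq.eventually (lt_mem_nhds (by rw [hz]; exact hlt))
      filter_upwards [nhdsWithin_le_nhds h1, nhdsWithin_le_nhds hpos, self_mem_nhdsWithin]
        with s h1 h2 h3
      have h3 : s < 1 := h3
      refine ⟨?_, ?_⟩ <;> rw [hq s h2]
      · exact h1
      · rw [hz]; nlinarith
  · rintro ⟨h1, h2⟩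
    rcases hz with hz | hz <;> linarith

/-- the lifting from the Dirichlet problem `−Δv = f(v)/(2|z|)` on the annulus
`D ⊂ ℝ^{m+1}` for axially symmetric `v ∈ C²(D̄)` to the Dirichlet problem `−Δu = f(u)` on the
annulus `A ⊂ ℝ^{2m}` for the `O(m)×O(m)`-invariant function
`u(y₁,y₂) := v(|y₁||y₂|·e₁, (|y₁|²−|y₂|²)/2)`. -/
theorem stmt_6 (m : ℕ) (hm : 2 ≤ m) (a b : ℝ) (ha : 0 < a) (hab : a < b)
    (f : ℝ → ℝ) (hf : ContDiff ℝ 1 f)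
    (v : EuclideanSpace ℝ (Fin m) × ℝ → ℝ)
    (hreg : ContDiffOn ℝ 2 v (closure (AnnD m a b)))
    (hax : ∀ z ∈ closure (AnnD m a b), ∀ w ∈ closure (AnnD m a b),
      ‖z.1‖ = ‖w.1‖ → z.2 = w.2 → v z = v w)
    (heq : ∀ z ∈ AnnD m a b, -lapQ v z = f (v z) / (2 * qnorm z))
    (hbd : ∀ z ∈ frontier (AnnD m a b), v z = 0) :
    ∀ u : EuclideanSpace ℝ (Fin m) × EuclideanSpace ℝ (Fin m) → ℝ,
      u = (fun x => v ((‖x.1‖ * ‖x.2‖) • EuclideanSpace.single (⟨0, by omega⟩ : Fin m) (1 : ℝ),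
        (‖x.1‖ ^ 2 - ‖x.2‖ ^ 2) / 2)) →
      ContDiffOn ℝ 2 u (Ann m a b) ∧
      (∀ x ∈ closure (Ann m a b), ∀ x' ∈ closure (Ann m a b),
        ‖x.1‖ = ‖x'.1‖ → ‖x.2‖ = ‖x'.2‖ → u x = u x') ∧
      (∀ x ∈ Ann m a b, -lapP u x = f (u x)) ∧
      (∀ x ∈ frontier (Ann m a b), u x = 0) := by

  intro u hu
  have hsub : AnnD m a b ⊆ closure (AnnD m a b) := subset_closure
  have hreg' := hreg.mono hsub
  have hax' : ∀ z ∈ AnnD m a b, ∀ w ∈ AnnD m a b, ‖z.1‖ = ‖w.1‖ → z.2 = w.2 → v z = v w :=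
    fun z hz w hw => hax z (hsub hz) w (hsub hw)
  have hΦ0 : ∀ x : EuclideanSpace ℝ (Fin m) × EuclideanSpace ℝ (Fin m),
      ‖((‖x.1‖ * ‖x.2‖) • EuclideanSpace.single (⟨0, by omega⟩ : Fin m) (1 : ℝ))‖
        = ‖x.1‖ * ‖x.2‖ := by
    intro x; simp [norm_smul]
  have hmem0 : ∀ x ∈ Ann m a b, ((‖x.1‖ * ‖x.2‖) •
      EuclideanSpace.single (⟨0, by omega⟩ : Fin m) (1 : ℝ), (‖x.1‖ ^ 2 - ‖x.2‖ ^ 2) / 2)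
      ∈ AnnD m a b := fun x hx => mem_AnnD_of ha hab _ x hx (hΦ0 x) rfl
  have hmem1 : ∀ x ∈ Ann m a b, liftMap 1 x ∈ AnnD m a b := by
    intro x hx
    refine mem_AnnD_of ha hab _ x hx ?_ ?_
    · simp [liftMap, norm_smul, mul_comm]
    · simp [liftMap]
  have hmem2 : ∀ x ∈ Ann m a b, liftMap (-1) x.swap ∈ AnnD m a b := by
    intro x hx
    refine mem_AnnD_of ha hab _ x hx ?_ ?_
    · simp [liftMap, norm_smul]
    · simp [liftMap]; ring
  have hu1 : ∀ x ∈ Ann m a b, u x = v (liftMap 1 x) := by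
    intro x hx
    rw [hu]
    refine hax' _ (hmem0 x hx) _ (hmem1 x hx) ?_ ?_
    · simp [liftMap, norm_smul, mul_comm]
    · simp [liftMap]
  have hu2 : ∀ x ∈ Ann m a b, u x = v (liftMap (-1) x.swap) := by
    intro x hx
    rw [hu]
    refine hax' _ (hmem0 x hx) _ (hmem2 x hx) ?_ ?_
    · simp [liftMap, norm_smul]
    · simp [liftMap]; ring
  have hne : ∀ x ∈ Ann m a b, x.2 ≠ 0 ∨ x.1 ≠ 0 := by
    intro x hx
    by_contra! h
    have := hx.1
    simp [pnorm, h.1, h.2] at this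
    linarith
  have hcdv : ∀ z ∈ AnnD m a b, ContDiffAt ℝ 2 v z := fun z hz =>
    hreg'.contDiffAt ((isOpen_AnnD m a b).mem_nhds hz)
  have hE1 : ∀ x ∈ Ann m a b, u =ᶠ[𝓝 x] fun y => v (liftMap 1 y) := by
    intro x hx
    filter_upwards [(isOpen_Ann m a b).mem_nhds hx] with y hy using hu1 y hy
  have hE2 : ∀ x ∈ Ann m a b, u =ᶠ[𝓝 x] fun y => v (liftMap (-1) y.swap) := by
    intro x hx
    filter_upwards [(isOpen_Ann m a b).mem_nhds hx] with y hy using hu2 y hy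
  refine ⟨?_, ?_, ?_, ?_⟩
  · intro x hx
    refine ContDiffAt.contDiffWithinAt ?_
    rcases hne x hx with h | h
    · refine ContDiffAt.congr_of_eventuallyEq ?_ (hE1 x hx)
      exact (hcdv _ (hmem1 x hx)).comp x (liftMap_contDiffAt 1 x h)
    · refine ContDiffAt.congr_of_eventuallyEq ?_ (hE2 x hx)
      have h3 : ContDiffAt ℝ 2 (fun y : EuclideanSpace ℝ (Fin m) × EuclideanSpace ℝ (Fin m) =>
          liftMap (-1) y.swap) x :=
        (liftMap_contDiffAt (-1) x.swap h).comp x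
          (contDiffAt_snd.prodMk contDiffAt_fst)
      exact (hcdv _ (hmem2 x hx)).comp x h3
  · intro x _ x' _ h1 h2
    simp only [hu, h1, h2]
  · intro x hx
    have hpos : 0 < pnorm x := ha.trans hx.1
    have hp2 : pnorm x ^ 2 = ‖x.1‖ ^ 2 + ‖x.2‖ ^ 2 := by
      rw [pnorm, Real.sq_sqrt (by positivity)]
    have fin : ∀ z ∈ AnnD m a b, qnorm z = pnorm x ^ 2 / 2 → u x = v z →
        lapP u x = (‖x.1‖ ^ 2 + ‖x.2‖ ^ 2) * lapQ v z → -lapP u x = f (u x) := by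
      intro z hz hq huz hl
      have := heq z hz
      rw [hq] at this
      rw [hl, huz, ← hp2, ← mul_neg, this]
      field_simp
    rcases hne x hx with h | h
    · refine fin _ (hmem1 x hx) ?_ (hu1 x hx) ?_
      · refine qnorm_of _ x ?_ ?_
        · simp [liftMap, norm_smul, mul_comm]
        · simp [liftMap]
      · rw [lapP_congr (hE1 x hx)]
        exact aux_key v hreg' hax' 1 (by norm_num) x h (hmem1 x hx)
    · refine fin _ (hmem2 x hx) ?_ (hu2 x hx) ?_
      · refine qnorm_of _ x ?_ ?_
        · simp [liftMap, norm_smul]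
        · simp [liftMap]; ring
      · rw [lapP_congr (hE2 x hx), lapP_swap (fun y => v (liftMap (-1) y)) x,
          aux_key v hreg' hax' (-1) (by norm_num) x.swap h (hmem2 x hx)]
        simp only [Prod.fst_swap, Prod.snd_swap]
        ring
  · intro x hx
    rw [hu]
    refine hbd _ (frontier_AnnD_of ha hab _ ?_)
    have hq := qnorm_of ((‖x.1‖ * ‖x.2‖) • EuclideanSpace.single (⟨0, by omega⟩ : Fin m) (1 : ℝ),
      (‖x.1‖ ^ 2 - ‖x.2‖ ^ 2) / 2) x (hΦ0 x) rfl
    rw [hq]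
    rw [(isOpen_Ann m a b).frontier_eq] at hx
    have hcl : x ∈ {x | a ≤ pnorm x ∧ pnorm x ≤ b} := by
      have hclosed : IsClosed {x : EuclideanSpace ℝ (Fin m) × EuclideanSpace ℝ (Fin m) |
          a ≤ pnorm x ∧ pnorm x ≤ b} :=
        (isClosed_le continuous_const continuous_pnorm).inter
          (isClosed_le continuous_pnorm continuous_const)
      have hss : Ann m a b ⊆ {x | a ≤ pnorm x ∧ pnorm x ≤ b} :=
        fun y hy => ⟨le_of_lt hy.1, le_of_lt hy.2⟩
      exact closure_minimal hss hclosed hx.1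
    rcases eq_or_lt_of_le hcl.1 with h | h
    · left; rw [← h]
    · rcases eq_or_lt_of_le hcl.2 with h' | h'
      · right; rw [h']
      · exact absurd ⟨h, h'⟩ hx.2
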